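/- Let 0 < b ≤ 1/2. There is a constant c such that for all Schwartz functions ψ : ℝ → ℂ and u : ℝ×ℝ² → ℂ, the pointwise product (ψu)(t,x) = ψ(t)u(t,x) satisfies the one-dimensional Besov multiplication law ∑_{k≥0} 2^{bk} ‖φ_k ∗_t (ψu)‖_{L²(ℝ×ℝ²)} ≤ c (∑_{k≥0} 2^{bk} ‖φ_k ∗ ψ‖_{L²(ℝ)}) (∑_{k≥0} 2^{k/2} ‖φ_k ∗_t u‖_{L²(ℝ×ℝ²)}), i.e. ‖ψu‖_{B^b_{2,1}L²_x} ≤ c ‖ψ‖_{B^b_{2,1}} ‖u‖_{B^{1/2}_{2,1}L²_x}. -/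

import Mathlib

open MeasureTheory Complex
open scoped RealInnerProductSpace

noncomputable section

/-- ℝ² with the Euclidean norm. -/
abbrev E2 : Type := EuclideanSpace ℝ (Fin 2)

/-- Space-time ℝ × ℝ². -/
abbrev SpaceTime : Type := ℝ × E2

/-- Space–time Fourier transform f̃(τ,ξ). -/
def ftST (f : SpaceTime → ℂ) (τ : ℝ) (ξ : E2) : ℂ :=
  ∫ p : SpaceTime, Complex.exp (-Complex.I * ((p.1 * τ + ⟪p.2, ξ⟫ : ℝ) : ℂ)) * f p

/-- Spatial Fourier transform. -/
def ftX (f : E2 → ℂ) (ξ : E2) : ℂ :=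
  ∫ x : E2, Complex.exp (-Complex.I * ((⟪x, ξ⟫ : ℝ) : ℂ)) * f x

/-- Japanese bracket ⟨x⟩ = (1+x²)^{1/2}. -/
def jap (x : ℝ) : ℝ := Real.sqrt (1 + x ^ 2)

/-- L² norm in the Fourier variables (τ,ξ). -/
def l2F (g : ℝ → E2 → ℂ) : ℝ := Real.sqrt (∫ τ : ℝ, ∫ ξ : E2, ‖g τ ξ‖ ^ 2)

/-- Classical wave-Bourgain norm ‖f‖_{X^{a,b}_s}. -/
def Xnorm (a b s : ℝ) (f : SpaceTime → ℂ) : ℝ :=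
  l2F fun τ ξ => ((jap ‖ξ‖ ^ a * jap (τ + s * ‖ξ‖) ^ b : ℝ) : ℂ) * ftST f τ ξ

/-- The hypotheses on the Littlewood–Paley bump function φ. -/
structure IsLPBump (φ : ℝ → ℝ) : Prop where
  smooth : ContDiff ℝ (⊤ : ℕ∞) φ
  compactSupport : HasCompactSupport φ
  nonneg : ∀ τ, 0 ≤ φ τ
  support_subset : ∀ τ, φ τ ≠ 0 → 1 / 2 ≤ |τ| ∧ |τ| ≤ 2
  pos : ∀ τ, 1 / Real.sqrt 2 ≤ |τ| → |τ| ≤ Real.sqrt 2 → 0 < φ τ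

/-- ∑_{j∈ℤ} φ(2^{−j}τ). -/
def lpSum (φ : ℝ → ℝ) (τ : ℝ) : ℝ := ∑' j : ℤ, φ (τ / 2 ^ j)

/-- The Littlewood–Paley pieces φ̂_k: φ̂_k(τ) = φ(2^{−k}τ)/∑_{j∈ℤ}φ(2^{−j}τ) for k ≥ 1,
    φ̂_0 = 1 − ∑_{k≥1} φ̂_k. -/
def lpPiece (φ : ℝ → ℝ) : ℕ → ℝ → ℝ
  | 0, τ => 1 - ∑' k : ℕ, φ (τ / 2 ^ (k + 1)) / lpSum φ τ
  | k + 1, τ => φ (τ / 2 ^ (k + 1)) / lpSum φ τ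

/-- Bourgain–Besov norm ‖f‖_{X^{a,b,1}_s}. -/
def XnormB (φ : ℝ → ℝ) (a b s : ℝ) (f : SpaceTime → ℂ) : ℝ :=
  ∑' k : ℕ, (2 : ℝ) ^ (b * k) *
    l2F fun τ ξ => ((jap ‖ξ‖ ^ a * lpPiece φ k (τ + s * ‖ξ‖) : ℝ) : ℂ) * ftST f τ ξ

/-- Bourgain–Besov norm ‖f‖_{X^{a,b,∞}_s}. -/
def XnormBinf (φ : ℝ → ℝ) (a b s : ℝ) (f : SpaceTime → ℂ) : ℝ :=
  ⨆ k : ℕ, (2 : ℝ) ^ (b * k) *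
    l2F fun τ ξ => ((jap ‖ξ‖ ^ a * lpPiece φ k (τ + s * ‖ξ‖) : ℝ) : ℂ) * ftST f τ ξ

/-- Mixed norm ‖f‖_{L^q_t L^r_x}. -/
def mixedNorm (q r : ℝ) (f : SpaceTime → ℂ) : ℝ :=
  (∫ t : ℝ, (∫ x : E2, ‖f (t, x)‖ ^ r) ^ (q / r)) ^ (1 / q)

/-- L² norm on the slab [0,T] × ℝ². -/
def l2Slab (T : ℝ) (f : SpaceTime → ℂ) : ℝ :=
  Real.sqrt (∫ t in Set.Icc (0 : ℝ) T, ∫ x : E2, ‖f (t, x)‖ ^ 2)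
/-- φ_k, the inverse Fourier transform (in one variable) of the Littlewood–Paley
    piece φ̂_k. -/
def lpKernel (φ : ℝ → ℝ) (k : ℕ) (t : ℝ) : ℂ :=
  ((2 * Real.pi)⁻¹ : ℝ) • ∫ τ : ℝ, Complex.exp (Complex.I * ((t * τ : ℝ) : ℂ)) * (lpPiece φ k τ : ℂ)

/-- Convolution in the time variable only. -/
def convT (h : ℝ → ℂ) (u : SpaceTime → ℂ) (p : SpaceTime) : ℂ :=
  ∫ s : ℝ, h (p.1 - s) * u (s, p.2)

/-- Convolution on ℝ. -/
def convR (h : ℝ → ℂ) (g : ℝ → ℂ) (t : ℝ) : ℂ :=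
  ∫ s : ℝ, h (t - s) * g s

/-- L² norm on ℝ×ℝ². -/
def l2ST (f : SpaceTime → ℂ) : ℝ := Real.sqrt (∫ p : SpaceTime, ‖f p‖ ^ 2)

/-- L² norm on ℝ. -/
def l2R (g : ℝ → ℂ) : ℝ := Real.sqrt (∫ t : ℝ, ‖g t‖ ^ 2)

open scoped FourierTransform ENNReal

theorem integral_fourier_mul_eq {f g : ℝ → ℂ} (hf : Integrable f) (hg : Integrable g) :
    ∫ w, 𝓕 f w * g w = ∫ x, f x * 𝓕 g x := by
  have := VectorFourier.integral_fourierIntegral_smul_eq_flip (μ := (volume : Measure ℝ))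
    (ν := (volume : Measure ℝ)) (L := innerₗ ℝ) (f := f) (g := g)
    Real.continuous_fourierChar continuous_inner hf hg
  rw [flip_innerₗ] at this
  exact this

theorem continuous_fourier_of_integrable {f : ℝ → ℂ} (hf : Integrable f) : Continuous (𝓕 f) :=
  VectorFourier.fourierIntegral_continuous Real.continuous_fourierChar continuous_inner hf

theorem norm_fourier_le_integral_norm (f : ℝ → ℂ) (w : ℝ) : ‖𝓕 f w‖ ≤ ∫ x, ‖f x‖ :=
  VectorFourier.norm_fourierIntegral_le_integral_norm _ _ _ _ _

theorem toLp_fourier_ae_eq {f : ℝ → ℂ} (hf : Integrable f) (hf2 : MemLp f 2) :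
    (𝓕 (hf2.toLp f) : Lp ℂ 2 (volume : Measure ℝ)) =ᵐ[volume] 𝓕 f := by
  have hc := continuous_fourier_of_integrable hf
  have hloc : LocallyIntegrable
      (fun x => (𝓕 (hf2.toLp f) : Lp ℂ 2 (volume : Measure ℝ)) x - 𝓕 f x) volume :=
    ((Lp.memLp _).locallyIntegrable (by norm_num)).sub hc.locallyIntegrable
  have key := ae_eq_zero_of_integral_contDiff_smul_eq_zero hloc ?_
  · filter_upwards [key] with x hx
    exact sub_eq_zero.1 hx
  intro g g_smooth g_cpt
  have hg₁ : HasCompactSupport (Complex.ofRealCLM ∘ g) := g_cpt.comp_left rfl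
  have hg₂ : ContDiff ℝ (⊤ : ℕ∞) (Complex.ofRealCLM ∘ g) := by fun_prop
  set G : SchwartzMap ℝ ℂ := hg₁.toSchwartzMap hg₂ with hG
  have hGx : ∀ x, G x = (g x : ℂ) := fun x => rfl
  have e1 : ∫ x, G x • (𝓕 (hf2.toLp f) : Lp ℂ 2 (volume : Measure ℝ)) x =
      ∫ x, G x * 𝓕 f x := by
    rw [← Lp.toTemperedDistribution_apply, ← Lp.fourier_toTemperedDistribution_eq,
      TemperedDistribution.fourier_apply, Lp.toTemperedDistribution_apply,
      ← integral_fourier_mul_eq G.integrable hf]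
    refine integral_congr_ae ?_
    filter_upwards [hf2.coeFn_toLp] with x hx
    rw [hx, SchwartzMap.fourier_coe, smul_eq_mul]
  have i1 := hloc.integrable_smul_left_of_hasCompactSupport g_smooth.continuous g_cpt
  have i2 := (hc.locallyIntegrable (μ := volume)).integrable_smul_left_of_hasCompactSupport
    g_smooth.continuous g_cpt
  have i3 := ((Lp.memLp (𝓕 (hf2.toLp f) : Lp ℂ 2 (volume : Measure ℝ))).locallyIntegrable
    (by norm_num)).integrable_smul_left_of_hasCompactSupport g_smooth.continuous g_cpt
  simp only [smul_sub]
  rw [integral_sub i3 i2, sub_eq_zero]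
  simpa only [hGx, smul_eq_mul, Complex.real_smul] using e1

theorem lintegral_enorm_sq_eq_eLpNorm_sq {Ω : Type*} [MeasurableSpace Ω] (μ : Measure Ω)
    (f : Ω → ℂ) : ∫⁻ x, ‖f x‖ₑ ^ 2 ∂μ = eLpNorm f 2 μ ^ 2 := by
  have := eLpNorm_nnreal_pow_eq_lintegral (f := f) (μ := μ) (p := 2) (by norm_num)
  simpa using this.symm

theorem lintegral_enorm_fourier_sq {f : ℝ → ℂ} (hf : Integrable f) (hf2 : MemLp f 2) :
    ∫⁻ w, ‖𝓕 f w‖ₑ ^ 2 = ∫⁻ x, ‖f x‖ₑ ^ 2 := by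
  rw [lintegral_enorm_sq_eq_eLpNorm_sq, lintegral_enorm_sq_eq_eLpNorm_sq,
    ← eLpNorm_congr_ae (toLp_fourier_ae_eq hf hf2), ← eLpNorm_congr_ae hf2.coeFn_toLp]
  have h := Lp.norm_fourier_eq (hf2.toLp f)
  rw [Lp.norm_def, Lp.norm_def,
    ENNReal.toReal_eq_toReal_iff' (Lp.eLpNorm_ne_top _) (Lp.eLpNorm_ne_top _)] at h
  rw [h]

theorem lintegral_enorm_fourierInv_sq {f : ℝ → ℂ} (hf : Integrable f) (hf2 : MemLp f 2) :
    ∫⁻ w, ‖𝓕⁻ f w‖ₑ ^ 2 = ∫⁻ x, ‖f x‖ₑ ^ 2 := by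
  rw [← lintegral_enorm_fourier_sq hf hf2,
    ← lintegral_neg_eq_self (fun w => ‖𝓕 f w‖ₑ ^ 2)]
  simp only [Real.fourierInv_eq_fourier_neg]

/-- The Fourier transform of a product is dominated by the convolution of the transforms. -/
theorem enorm_fourier_mul_le (ψ : SchwartzMap ℝ ℂ) {v : ℝ → ℂ} (hv : Integrable v) (w : ℝ) :
    ‖𝓕 (fun t => ψ t * v t) w‖ₑ ≤ ∫⁻ σ, ‖𝓕 (ψ : ℝ → ℂ) (w - σ)‖ₑ * ‖𝓕 v σ‖ₑ := by
  set P : SchwartzMap ℝ ℂ := 𝓕⁻ ψ with hP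
  have hψ : (ψ : ℝ → ℂ) = 𝓕 (P : ℝ → ℂ) := by
    rw [← SchwartzMap.fourier_coe, hP, FourierTransform.fourier_fourierInv_eq]
  set m : ℝ → ℂ := fun t => Real.fourierChar (-(t * w)) • v t with hm
  have hmi : Integrable m := by
    have := (Real.fourierIntegral_convergent_iff (μ := volume) (f := v) w).2 hv
    refine this.congr (Filter.Eventually.of_forall fun t => ?_)
    simp [hm, mul_comm]
  have hFm : ∀ σ, 𝓕 m σ = 𝓕 v (σ + w) := by
    intro σ
    rw [Real.fourier_real_eq, Real.fourier_real_eq]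
    refine integral_congr_ae (Filter.Eventually.of_forall fun t => ?_)
    simp only [hm, smul_smul, ← AddChar.map_add_eq_mul]
    ring_nf
  have e : 𝓕 (fun t => ψ t * v t) w = ∫ σ, P σ * 𝓕 v (σ + w) := by
    simp only [← hFm]
    rw [← integral_fourier_mul_eq P.integrable hmi, ← hψ, Real.fourier_real_eq]
    refine integral_congr_ae (Filter.Eventually.of_forall fun t => ?_)
    simp [hm, Circle.smul_def]
    ring
  rw [e]
  refine (enorm_integral_le_lintegral_enorm _).trans (le_of_eq ?_)
  rw [← lintegral_sub_right_eq_self _ w]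
  refine lintegral_congr fun σ => ?_
  rw [enorm_mul, sub_add_cancel, hP, SchwartzMap.fourierInv_coe,
    Real.fourierInv_eq_fourier_neg, neg_sub]

/-- The `L²` norm of a nonnegative extended real valued function. -/
def lTwo {Ω : Type*} [MeasurableSpace Ω] (μ : Measure Ω) (f : Ω → ℝ≥0∞) : ℝ≥0∞ :=
  (∫⁻ x, f x ^ 2 ∂μ) ^ (1 / 2 : ℝ)

section LTwo

variable {Ω S : Type*} [MeasurableSpace Ω] [MeasurableSpace S] {μ : Measure Ω} {ν : Measure S}

theorem rpow_half_sq (a : ℝ≥0∞) : (a ^ (1 / 2 : ℝ)) ^ 2 = a := by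
  rw [← ENNReal.rpow_natCast, ← ENNReal.rpow_mul]
  norm_num

theorem sq_rpow_half (a : ℝ≥0∞) : (a ^ 2) ^ (1 / 2 : ℝ) = a := by
  rw [← ENNReal.rpow_natCast, ← ENNReal.rpow_mul]
  norm_num

theorem lTwo_mono {f g : Ω → ℝ≥0∞} (h : ∀ x, f x ≤ g x) : lTwo μ f ≤ lTwo μ g := by
  unfold lTwo
  gcongr with x
  exact h x

theorem lTwo_const_mul (c : ℝ≥0∞) {f : Ω → ℝ≥0∞} (hf : Measurable f) :
    lTwo μ (fun x => c * f x) = c * lTwo μ f := by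
  unfold lTwo
  simp only [mul_pow]
  rw [lintegral_const_mul _ (hf.pow_const 2), ENNReal.mul_rpow_of_nonneg _ _ (by norm_num),
    sq_rpow_half]

theorem lintegral_mul_le_lTwo {f g : Ω → ℝ≥0∞} (hf : Measurable f) (hg : Measurable g) :
    ∫⁻ x, f x * g x ∂μ ≤ lTwo μ f * lTwo μ g := by
  have := ENNReal.lintegral_mul_le_Lp_mul_Lq μ Real.HolderConjugate.two_two
    hf.aemeasurable hg.aemeasurable
  simpa [lTwo] using this

/-- Minkowski's integral inequality in `L²`. -/
theorem lTwo_lintegral_le [SFinite μ] [SFinite ν] {F : Ω → S → ℝ≥0∞}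
    (hF : Measurable (Function.uncurry F)) :
    lTwo μ (fun x => ∫⁻ s, F x s ∂ν) ≤ ∫⁻ s, lTwo μ (fun x => F x s) ∂ν := by
  have hx : ∀ x, Measurable (F x) := fun x => hF.of_uncurry_left
  have hs : ∀ s, Measurable (fun x => F x s) := fun s => hF.of_uncurry_right
  have hN : Measurable fun s => lTwo μ (fun x => F x s) := by
    unfold lTwo
    refine Measurable.pow_const ?_ _
    exact Measurable.lintegral_prod_left (f := fun (x : Ω) (s : S) => F x s ^ 2) (hF.pow_const 2)
  have key : ∫⁻ x, (∫⁻ s, F x s ∂ν) ^ 2 ∂μ ≤ (∫⁻ s, lTwo μ (fun x => F x s) ∂ν) ^ 2 := by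
    calc ∫⁻ x, (∫⁻ s, F x s ∂ν) ^ 2 ∂μ
        = ∫⁻ x, ∫⁻ p : S × S, F x p.1 * F x p.2 ∂(ν.prod ν) ∂μ := by
          refine lintegral_congr fun x => ?_
          rw [lintegral_prod_mul (hx x).aemeasurable (hx x).aemeasurable, sq]
      _ = ∫⁻ p : S × S, ∫⁻ x, F x p.1 * F x p.2 ∂μ ∂(ν.prod ν) := by
          rw [lintegral_lintegral_swap]
          refine Measurable.aemeasurable ?_
          exact (hF.comp (measurable_fst.prodMk (measurable_fst.comp measurable_snd))).mul
            (hF.comp (measurable_fst.prodMk (measurable_snd.comp measurable_snd)))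
      _ ≤ ∫⁻ p : S × S, lTwo μ (fun x => F x p.1) * lTwo μ (fun x => F x p.2) ∂(ν.prod ν) :=
          lintegral_mono fun p => lintegral_mul_le_lTwo (hs _) (hs _)
      _ = _ := by rw [lintegral_prod_mul hN.aemeasurable hN.aemeasurable, sq]
  calc lTwo μ (fun x => ∫⁻ s, F x s ∂ν)
      ≤ ((∫⁻ s, lTwo μ (fun x => F x s) ∂ν) ^ 2) ^ (1 / 2 : ℝ) := by
        unfold lTwo at key ⊢
        gcongr
    _ = _ := sq_rpow_half _

theorem lTwo_tsum_le [SFinite μ] {ι : Type*} [Countable ι] {F : ι → Ω → ℝ≥0∞}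
    (hF : ∀ i, Measurable (F i)) :
    lTwo μ (fun x => ∑' i, F i x) ≤ ∑' i, lTwo μ (F i) := by
  let _ : MeasurableSpace ι := ⊤
  have h := lTwo_lintegral_le (μ := μ) (ν := (Measure.count : Measure ι))
    (F := fun x i => F i x) (measurable_from_prod_countable_left fun i => hF i)
  simpa only [lintegral_count] using h

end LTwo

theorem lintegral_le_of_support {f : ℝ → ℝ≥0∞} (hf : Measurable f) {n : ℕ}
    (hs : ∀ w, f w ≠ 0 → |w| ≤ 2 ^ n) :
    ∫⁻ w, f w ≤ 2 ^ (1 / 2 : ℝ) * 2 ^ ((n : ℝ) / 2) * lTwo volume f := by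
  set I : Set ℝ := Set.Icc (-2 ^ n) (2 ^ n) with hI
  have hIm : Measurable (I.indicator (1 : ℝ → ℝ≥0∞)) :=
    measurable_one.indicator measurableSet_Icc
  have h1 : ∀ w, f w = I.indicator (1 : ℝ → ℝ≥0∞) w * f w := by
    intro w
    by_cases hw : f w = 0
    · simp [hw]
    · have : w ∈ I := by rw [hI, Set.mem_Icc]; exact abs_le.1 (hs w hw)
      simp [this]
  have h2 : lTwo volume (I.indicator (1 : ℝ → ℝ≥0∞)) = 2 ^ (1 / 2 : ℝ) * 2 ^ ((n : ℝ) / 2) := by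
    have : ∀ w, I.indicator (1 : ℝ → ℝ≥0∞) w ^ 2 = I.indicator 1 w := by
      intro w
      by_cases hw : w ∈ I <;> simp [hw]
    unfold lTwo
    simp only [this]
    rw [lintegral_indicator_one measurableSet_Icc, Real.volume_Icc]
    have : ENNReal.ofReal (2 ^ n - -2 ^ n) = 2 * 2 ^ (n : ℝ) := by
      rw [sub_neg_eq_add, ← two_mul, ENNReal.ofReal_mul (by norm_num),
        ENNReal.ofReal_pow (by norm_num), ENNReal.rpow_natCast]
      simp
    rw [this, ENNReal.mul_rpow_of_nonneg _ _ (by norm_num), ← ENNReal.rpow_mul]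
    congr 2
    ring
  calc ∫⁻ w, f w = ∫⁻ w, I.indicator (1 : ℝ → ℝ≥0∞) w * f w := lintegral_congr h1
    _ ≤ _ := (lintegral_mul_le_lTwo hIm hf).trans_eq (by rw [h2])

/-- A measurable partition of unity on `ℝ` subordinate to dyadic annuli. -/
structure IsDyadicPartition (m : ℕ → ℝ → ℝ≥0∞) : Prop where
  measurable : ∀ k, Measurable (m k)
  tsum_eq_one : ∀ w, ∑' k, m k w = 1
  abs_le : ∀ k w, m k w ≠ 0 → |w| ≤ 2 ^ k
  le_abs : ∀ k w, m k w ≠ 0 → k ≠ 0 → (2 : ℝ) ^ k / 16 ≤ |w|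

namespace IsDyadicPartition

variable {m : ℕ → ℝ → ℝ≥0∞} {X : Type*} [MeasurableSpace X] {ν : Measure X}

theorem le_one (hm : IsDyadicPartition m) (k : ℕ) (w : ℝ) : m k w ≤ 1 :=
  (ENNReal.le_tsum k).trans_eq (hm.tsum_eq_one w)

theorem index_le (hm : IsDyadicPartition m) {j k l : ℕ} {w σ : ℝ} (hk : m k w ≠ 0)
    (hj : m j (w - σ) ≠ 0) (hl : m l σ ≠ 0) : k ≤ max j l + 5 := by
  by_contra! hlt
  have h1 := hm.le_abs k w hk (by omega)
  have h2 := hm.abs_le j _ hj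
  have h3 := hm.abs_le l _ hl
  have h4 : |w| ≤ |w - σ| + |σ| := by simpa using abs_add_le (w - σ) σ
  have h5 : (2 : ℝ) ^ j ≤ 2 ^ max j l := pow_le_pow_right₀ (by norm_num) (le_max_left _ _)
  have h6 : (2 : ℝ) ^ l ≤ 2 ^ max j l := pow_le_pow_right₀ (by norm_num) (le_max_right _ _)
  have h7 : (2 : ℝ) ^ (max j l + 6) ≤ 2 ^ k := pow_le_pow_right₀ (by norm_num) hlt
  have h8 : (0 : ℝ) < 2 ^ max j l := by positivity
  rw [pow_add] at h7
  linarith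

/-- The convolution in the first variable of two frequency localised functions. -/
def piece (m : ℕ → ℝ → ℝ≥0∞) (f : ℝ → ℝ≥0∞) (g : ℝ × X → ℝ≥0∞) (j l : ℕ) (p : ℝ × X) : ℝ≥0∞ :=
  ∫⁻ σ, (m j (p.1 - σ) * f (p.1 - σ)) * (m l σ * g (σ, p.2))

variable {f : ℝ → ℝ≥0∞} {g h : ℝ × X → ℝ≥0∞}

theorem measurable_piece_integrand (hm : IsDyadicPartition m) (hf : Measurable f)
    (hg : Measurable g) (j l : ℕ) :
    Measurable (Function.uncurry fun (p : ℝ × X) (σ : ℝ) =>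
      (m j (p.1 - σ) * f (p.1 - σ)) * (m l σ * g (σ, p.2))) := by
  have h1 := hm.measurable j
  have h2 := hm.measurable l
  unfold Function.uncurry
  fun_prop

theorem measurable_piece (hm : IsDyadicPartition m) (hf : Measurable f)
    (hg : Measurable g) (j l : ℕ) : Measurable (piece m f g j l) :=
  (hm.measurable_piece_integrand hf hg j l).lintegral_prod_right

theorem mul_piece_le (hm : IsDyadicPartition m) (j k l : ℕ) (p : ℝ × X) :
    m k p.1 * piece m f g j l p ≤
      (if k ≤ max j l + 5 then 1 else 0) * piece m f g j l p := by
  split_ifs with hk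
  · gcongr
    exact hm.le_one k _
  rw [zero_mul, nonpos_iff_eq_zero]
  by_cases h0 : m k p.1 = 0
  · simp [h0]
  have : piece m f g j l p = 0 := by
    refine (lintegral_congr fun σ => ?_).trans lintegral_zero
    by_cases h1 : m j (p.1 - σ) = 0
    · simp [h1]
    by_cases h2 : m l σ = 0
    · simp [h2]
    exact absurd (hm.index_le h0 h1 h2) hk
  simp [this]

theorem le_tsum_piece (hm : IsDyadicPartition m) (hf : Measurable f) (hg : Measurable g)
    (hle : ∀ w x, h (w, x) ≤ ∫⁻ σ, f (w - σ) * g (σ, x)) (p : ℝ × X) :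
    h p ≤ ∑' q : ℕ × ℕ, piece m f g q.1 q.2 p := by
  refine (hle p.1 p.2).trans (le_of_eq ?_)
  have hmeas : ∀ q : ℕ × ℕ, AEMeasurable (fun σ : ℝ =>
      (m q.1 (p.1 - σ) * f (p.1 - σ)) * (m q.2 σ * g (σ, p.2))) volume := fun q =>
    ((hm.measurable_piece_integrand hf hg q.1 q.2).of_uncurry_left (x := p)).aemeasurable
  unfold piece
  rw [← lintegral_tsum hmeas]
  refine lintegral_congr fun σ => ?_
  rw [ENNReal.tsum_prod (f := fun (j l : ℕ) =>
    (m j (p.1 - σ) * f (p.1 - σ)) * (m l σ * g (σ, p.2)))]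
  simp only [ENNReal.tsum_mul_left, ENNReal.tsum_mul_right, hm.tsum_eq_one, one_mul]

variable [SFinite ν]

theorem lTwo_piece_le_left (hm : IsDyadicPartition m) (hf : Measurable f)
    (hg : Measurable g) (j l : ℕ) :
    lTwo (volume.prod ν) (piece m f g j l) ≤
      2 ^ (1 / 2 : ℝ) * 2 ^ ((j : ℝ) / 2) * lTwo volume (fun w => m j w * f w) *
        lTwo (volume.prod ν) (fun p => m l p.1 * g p) := by
  have hmj := hm.measurable j
  have hml := hm.measurable l
  have hF : Measurable (Function.uncurry fun (p : ℝ × X) (σ : ℝ) =>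
      (m j σ * f σ) * (m l (p.1 - σ) * g (p.1 - σ, p.2))) := by
    unfold Function.uncurry
    fun_prop
  have e1 : piece m f g j l = fun p : ℝ × X =>
      ∫⁻ σ, (m j σ * f σ) * (m l (p.1 - σ) * g (p.1 - σ, p.2)) := by
    funext p
    unfold piece
    rw [← lintegral_sub_left_eq_self _ p.1]
    simp
  have e2 : ∀ σ : ℝ, lTwo (volume.prod ν)
      (fun p : ℝ × X => (m j σ * f σ) * (m l (p.1 - σ) * g (p.1 - σ, p.2))) =
      (m j σ * f σ) * lTwo (volume.prod ν) (fun p => m l p.1 * g p) := by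
    intro σ
    rw [lTwo_const_mul _ (by fun_prop)]
    congr 1
    unfold lTwo
    congr 1
    rw [lintegral_prod_symm' _ (by fun_prop), lintegral_prod_symm' _ (by fun_prop)]
    refine lintegral_congr fun x => ?_
    exact lintegral_sub_right_eq_self (fun w => (m l w * g (w, x)) ^ 2) σ
  rw [e1]
  refine (lTwo_lintegral_le hF).trans ?_
  simp only [e2]
  rw [lintegral_mul_const _ (by fun_prop)]
  gcongr
  refine lintegral_le_of_support (by fun_prop) fun w hw => hm.abs_le j w (left_ne_zero_of_mul hw)

theorem lTwo_piece_le_right (hm : IsDyadicPartition m) (hf : Measurable f)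
    (hg : Measurable g) (j l : ℕ) :
    lTwo (volume.prod ν) (piece m f g j l) ≤
      2 ^ (1 / 2 : ℝ) * 2 ^ ((l : ℝ) / 2) * lTwo volume (fun w => m j w * f w) *
        lTwo (volume.prod ν) (fun p => m l p.1 * g p) := by
  have hmj := hm.measurable j
  have hml := hm.measurable l
  have e2 : ∀ σ : ℝ, lTwo (volume.prod ν)
      (fun p : ℝ × X => (m j (p.1 - σ) * f (p.1 - σ)) * (m l σ * g (σ, p.2))) =
      lTwo volume (fun w => m j w * f w) * lTwo ν (fun x => m l σ * g (σ, x)) := by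
    intro σ
    unfold lTwo
    rw [← ENNReal.mul_rpow_of_nonneg _ _ (by norm_num)]
    congr 1
    simp only [mul_pow]
    rw [lintegral_prod_mul (f := fun w => m j (w - σ) ^ 2 * f (w - σ) ^ 2)
      (g := fun x => m l σ ^ 2 * g (σ, x) ^ 2) (by fun_prop) (by fun_prop)]
    congr 1
    exact lintegral_sub_right_eq_self (fun w => m j w ^ 2 * f w ^ 2) σ
  have hN : Measurable fun σ => lTwo ν (fun x => m l σ * g (σ, x)) := by
    unfold lTwo
    refine Measurable.pow_const ?_ _
    refine Measurable.lintegral_prod_right (f := fun (σ : ℝ) (x : X) => (m l σ * g (σ, x)) ^ 2) ?_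
    unfold Function.uncurry
    fun_prop
  have e3 : lTwo volume (fun σ => lTwo ν (fun x => m l σ * g (σ, x))) =
      lTwo (volume.prod ν) (fun p => m l p.1 * g p) := by
    conv_lhs => unfold lTwo
    conv_rhs => unfold lTwo
    congr 1
    rw [lintegral_prod _ (by fun_prop)]
    refine lintegral_congr fun σ => ?_
    rw [rpow_half_sq]
  refine (lTwo_lintegral_le (hm.measurable_piece_integrand hf hg j l)).trans ?_
  simp only [e2]
  rw [lintegral_const_mul _ hN, mul_right_comm, mul_comm, ← e3]
  gcongr
  refine lintegral_le_of_support hN fun w hw => hm.abs_le l w fun h0 => hw ?_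
  simp [lTwo, h0]

theorem two_rpow_ne_top (x : ℝ) : (2 : ℝ≥0∞) ^ x ≠ ⊤ := by simp

theorem two_rpow_add (x y : ℝ) : (2 : ℝ≥0∞) ^ (x + y) = 2 ^ x * 2 ^ y :=
  ENNReal.rpow_add _ _ (by norm_num) (by norm_num)

theorem weight_mul_lTwo_piece_le (hm : IsDyadicPartition m) (hf : Measurable f)
    (hg : Measurable g) {b : ℝ} (hb : b ≤ 1 / 2) (j l : ℕ) :
    2 ^ (b * (max j l : ℕ)) * lTwo (volume.prod ν) (piece m f g j l) ≤
      2 ^ (1 / 2 : ℝ) * ((2 ^ (b * j) * lTwo volume (fun w => m j w * f w)) *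
        (2 ^ ((l : ℝ) / 2) * lTwo (volume.prod ν) (fun p => m l p.1 * g p))) := by
  rcases le_total j l with hjl | hjl
  · rw [max_eq_right hjl]
    have hw : (2 : ℝ≥0∞) ^ (b * l) * 2 ^ ((j : ℝ) / 2) ≤ 2 ^ (b * j) * 2 ^ ((l : ℝ) / 2) := by
      rw [← two_rpow_add, ← two_rpow_add]
      refine ENNReal.rpow_le_rpow_of_exponent_le (by norm_num) ?_
      have : (j : ℝ) ≤ l := by exact_mod_cast hjl
      nlinarith
    calc _ ≤ _ := mul_le_mul_right (hm.lTwo_piece_le_left hf hg j l) _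
      _ = 2 ^ (1 / 2 : ℝ) * ((2 ^ (b * l) * 2 ^ ((j : ℝ) / 2)) *
            (lTwo volume (fun w => m j w * f w) *
              lTwo (volume.prod ν) (fun p => m l p.1 * g p))) := by ring
      _ ≤ 2 ^ (1 / 2 : ℝ) * ((2 ^ (b * j) * 2 ^ ((l : ℝ) / 2)) *
            (lTwo volume (fun w => m j w * f w) *
              lTwo (volume.prod ν) (fun p => m l p.1 * g p))) := by gcongr
      _ = _ := by ring
  · rw [max_eq_left hjl]
    calc _ ≤ _ := mul_le_mul_right (hm.lTwo_piece_le_right hf hg j l) _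
      _ = _ := by ring

theorem tsum_weight_le (b : ℝ) (n : ℕ) :
    ∑' k : ℕ, (2 : ℝ≥0∞) ^ (b * k) * (if k ≤ n then 1 else 0) ≤
      2 ^ (b * n) * ∑' i : ℕ, ((2 : ℝ≥0∞) ^ (-b)) ^ i := by
  rw [tsum_eq_sum (s := Finset.range (n + 1)) fun k hk => by
    rw [if_neg (by simpa using hk), mul_zero]]
  rw [← Finset.sum_range_reflect]
  refine le_trans ?_ (mul_le_mul_right (ENNReal.sum_le_tsum (Finset.range (n + 1))) _)
  rw [Finset.mul_sum]
  refine Finset.sum_le_sum fun i hi => ?_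
  have hi' : i ≤ n := by simpa [Nat.lt_succ_iff] using hi
  rw [← ENNReal.rpow_natCast, ← ENNReal.rpow_mul, ← two_rpow_add, if_pos (by omega), mul_one]
  refine le_of_eq ?_
  congr 1
  rw [Nat.add_sub_cancel, Nat.cast_sub hi']
  ring

/-- The constant of the product estimate. -/
def productConst (b : ℝ) : ℝ≥0∞ :=
  2 ^ (b * 5) * (∑' i : ℕ, ((2 : ℝ≥0∞) ^ (-b)) ^ i) * 2 ^ (1 / 2 : ℝ)

theorem productConst_ne_top {b : ℝ} (hb : 0 < b) : productConst b ≠ ⊤ := by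
  unfold productConst
  refine ENNReal.mul_ne_top (ENNReal.mul_ne_top (two_rpow_ne_top _) ?_) (two_rpow_ne_top _)
  rw [ENNReal.tsum_geometric]
  refine ENNReal.inv_ne_top.2 ?_
  rw [Ne, tsub_eq_zero_iff_le, not_le]
  exact ENNReal.rpow_lt_one_of_one_lt_of_neg (by norm_num) (by linarith)

/-- The Besov product estimate on the Fourier side. -/
theorem tsum_mul_le (hm : IsDyadicPartition m) (hf : Measurable f) (hg : Measurable g)
    (hle : ∀ w x, h (w, x) ≤ ∫⁻ σ, f (w - σ) * g (σ, x)) {b : ℝ} (hb : b ≤ 1 / 2) :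
    ∑' k : ℕ, 2 ^ (b * k) * lTwo (volume.prod ν) (fun p => m k p.1 * h p) ≤
      productConst b * (∑' k : ℕ, 2 ^ (b * k) * lTwo volume (fun w => m k w * f w)) *
        ∑' k : ℕ, 2 ^ ((k : ℝ) / 2) * lTwo (volume.prod ν) (fun p => m k p.1 * g p) := by
  set N : ℕ × ℕ → ℝ≥0∞ := fun q => lTwo (volume.prod ν) (piece m f g q.1 q.2) with hN
  have h1 : ∀ k : ℕ, lTwo (volume.prod ν) (fun p => m k p.1 * h p) ≤
      ∑' q : ℕ × ℕ, (if k ≤ max q.1 q.2 + 5 then 1 else 0) * N q := by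
    intro k
    calc lTwo (volume.prod ν) (fun p => m k p.1 * h p)
        ≤ lTwo (volume.prod ν) (fun p => ∑' q : ℕ × ℕ,
            (if k ≤ max q.1 q.2 + 5 then 1 else 0) * piece m f g q.1 q.2 p) := by
          refine lTwo_mono fun p => ?_
          refine (mul_le_mul_right (hm.le_tsum_piece hf hg hle p) _).trans ?_
          rw [← ENNReal.tsum_mul_left]
          exact ENNReal.tsum_le_tsum fun q => hm.mul_piece_le q.1 k q.2 p
      _ ≤ ∑' q : ℕ × ℕ, lTwo (volume.prod ν) (fun p =>
            (if k ≤ max q.1 q.2 + 5 then 1 else 0) * piece m f g q.1 q.2 p) :=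
          lTwo_tsum_le fun q => (hm.measurable_piece hf hg q.1 q.2).const_mul _
      _ = _ := tsum_congr fun q => lTwo_const_mul _ (hm.measurable_piece hf hg q.1 q.2)
  set K : ℝ≥0∞ := ∑' i : ℕ, ((2 : ℝ≥0∞) ^ (-b)) ^ i with hK
  calc ∑' k : ℕ, 2 ^ (b * k) * lTwo (volume.prod ν) (fun p => m k p.1 * h p)
      ≤ ∑' k : ℕ, ∑' q : ℕ × ℕ,
          2 ^ (b * k) * ((if k ≤ max q.1 q.2 + 5 then 1 else 0) * N q) := by
        refine ENNReal.tsum_le_tsum fun k => ?_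
        rw [ENNReal.tsum_mul_left]
        gcongr
        exact h1 k
    _ = ∑' q : ℕ × ℕ,
          (∑' k : ℕ, 2 ^ (b * k) * (if k ≤ max q.1 q.2 + 5 then 1 else 0)) * N q := by
        rw [ENNReal.tsum_comm]
        simp only [← mul_assoc, ENNReal.tsum_mul_right]
    _ ≤ ∑' q : ℕ × ℕ, (2 ^ (b * 5) * K) * (2 ^ (b * (max q.1 q.2 : ℕ)) * N q) := by
        refine ENNReal.tsum_le_tsum fun q => ?_
        refine (mul_le_mul_left (tsum_weight_le b _) _).trans (le_of_eq ?_)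
        rw [Nat.cast_add, mul_add, two_rpow_add, ← hK]
        push_cast
        ring
    _ ≤ ∑' q : ℕ × ℕ, (2 ^ (b * 5) * K) * (2 ^ (1 / 2 : ℝ) *
          ((2 ^ (b * q.1) * lTwo volume (fun w => m q.1 w * f w)) *
        (2 ^ ((q.2 : ℝ) / 2) * lTwo (volume.prod ν) (fun p => m q.2 p.1 * g p)))) := by
        refine ENNReal.tsum_le_tsum fun q => mul_le_mul_right ?_ _
        exact hm.weight_mul_lTwo_piece_le hf hg hb q.1 q.2
    _ = _ := by
        rw [ENNReal.tsum_mul_left, ENNReal.tsum_mul_left, ENNReal.tsum_prod (f := fun (j l : ℕ) =>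
          (2 ^ (b * (j : ℝ)) * lTwo volume (fun w => m j w * f w)) *
        (2 ^ ((l : ℝ) / 2) * lTwo (volume.prod ν) (fun p => m l p.1 * g p)))]
        simp only [ENNReal.tsum_mul_left, ENNReal.tsum_mul_right]
        rw [productConst, ← hK]
        ring

end IsDyadicPartition

namespace IsDyadicPartition

variable {m : ℕ → ℝ → ℝ≥0∞} {Ω : Type*} [MeasurableSpace Ω] {μ : Measure Ω}

theorem le_mul_enorm (hm : IsDyadicPartition m) {k : ℕ} (hk : k ≠ 0) (w : ℝ) :
    m k w ≤ 16 * 2 ^ (-(k : ℝ)) * ‖w‖ₑ := by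
  by_cases h0 : m k w = 0
  · simp [h0]
  refine (hm.le_one k w).trans ?_
  have h1 := hm.le_abs k w h0 hk
  have h2 : (1 : ℝ) ≤ 16 * 2 ^ (-(k : ℝ)) * ‖w‖ := by
    rw [Real.rpow_neg (by norm_num), Real.rpow_natCast, Real.norm_eq_abs]
    have : (0 : ℝ) < 2 ^ k := by positivity
    field_simp
    linarith
  calc (1 : ℝ≥0∞) = ENNReal.ofReal 1 := by simp
    _ ≤ ENNReal.ofReal (16 * 2 ^ (-(k : ℝ)) * ‖w‖) := ENNReal.ofReal_le_ofReal h2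
    _ = _ := by
      rw [ENNReal.ofReal_mul (by positivity), ENNReal.ofReal_mul (by norm_num),
        ← ENNReal.ofReal_rpow_of_pos (by norm_num), ofReal_norm]
      simp

theorem tsum_weight_mul_lTwo_ne_top (hm : IsDyadicPartition m) {ω : Ω → ℝ} {g : Ω → ℝ≥0∞}
    (hω : Measurable ω) (hg : Measurable g) (h0 : lTwo μ g ≠ ⊤)
    (h1 : lTwo μ (fun x => ‖ω x‖ₑ * g x) ≠ ⊤) {b : ℝ} (hb : b ≤ 1 / 2) :
    ∑' k : ℕ, 2 ^ (b * k) * lTwo μ (fun x => m k (ω x) * g x) ≠ ⊤ := by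
  set A := lTwo μ g with hA
  set B := lTwo μ (fun x => ‖ω x‖ₑ * g x) with hB
  have hk : ∀ k : ℕ, lTwo μ (fun x => m k (ω x) * g x) ≤ 16 * 2 ^ (-(k : ℝ)) * (A + B) := by
    intro k
    rcases eq_or_ne k 0 with rfl | hk
    · calc lTwo μ (fun x => m 0 (ω x) * g x) ≤ A :=
            lTwo_mono fun x => mul_le_of_le_one_left' (hm.le_one 0 _)
        _ ≤ 1 * (A + B) := by rw [one_mul]; exact le_self_add
        _ ≤ _ := by
          gcongr
          simp
    · calc lTwo μ (fun x => m k (ω x) * g x)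
          ≤ lTwo μ (fun x => 16 * 2 ^ (-(k : ℝ)) * (‖ω x‖ₑ * g x)) := by
            refine lTwo_mono fun x => ?_
            rw [← mul_assoc]
            gcongr
            exact hm.le_mul_enorm hk _
        _ = 16 * 2 ^ (-(k : ℝ)) * B := lTwo_const_mul _ (by fun_prop)
        _ ≤ _ := by
          gcongr
          exact le_add_self
  refine ne_top_of_le_ne_top ?_ (ENNReal.tsum_le_tsum
    (g := fun k : ℕ => (16 * (A + B)) * ((2 : ℝ≥0∞) ^ (-(1 / 2) : ℝ)) ^ k) fun k => ?_)
  · rw [ENNReal.tsum_mul_left, ENNReal.tsum_geometric]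
    refine ENNReal.mul_ne_top (ENNReal.mul_ne_top (by norm_num) (ENNReal.add_ne_top.2 ⟨h0, h1⟩))
      (ENNReal.inv_ne_top.2 ?_)
    rw [Ne, tsub_eq_zero_iff_le, not_le]
    exact ENNReal.rpow_lt_one_of_one_lt_of_neg (by norm_num) (by norm_num)
  · refine (mul_le_mul_right (hk k) _).trans ?_
    have e : (2 : ℝ≥0∞) ^ (b * k) * 2 ^ (-(k : ℝ)) ≤ ((2 : ℝ≥0∞) ^ (-(1 / 2) : ℝ)) ^ k := by
      rw [← two_rpow_add, ← ENNReal.rpow_natCast, ← ENNReal.rpow_mul]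
      refine ENNReal.rpow_le_rpow_of_exponent_le (by norm_num) ?_
      have : (0 : ℝ) ≤ k := k.cast_nonneg
      nlinarith
    calc _ = (16 * (A + B)) * ((2 : ℝ≥0∞) ^ (b * k) * 2 ^ (-(k : ℝ))) := by ring
      _ ≤ _ := by gcongr

end IsDyadicPartition

namespace IsLPBump

variable {φ : ℝ → ℝ}

theorem apply_zero (hφ : IsLPBump φ) : φ 0 = 0 := by
  by_contra h
  have := (hφ.support_subset 0 h).1
  norm_num at this

theorem bounds_of_ne_zero (hφ : IsLPBump φ) {τ a : ℝ} (ha : 0 < a) (h : φ (τ / a) ≠ 0) :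
    a / 2 ≤ |τ| ∧ |τ| ≤ 2 * a := by
  have := hφ.support_subset _ h
  rw [abs_div, abs_of_pos ha, le_div_iff₀ ha, div_le_iff₀ ha] at this
  exact ⟨by linarith [this.1], this.2⟩

theorem summable_dyadic (hφ : IsLPBump φ) (τ : ℝ) : Summable fun j : ℤ => φ (τ / 2 ^ j) := by
  rcases eq_or_ne τ 0 with rfl | hτ
  · simp [hφ.apply_zero]
  obtain ⟨n, hn1, hn2⟩ := exists_mem_Ico_zpow (abs_pos.2 hτ) (one_lt_two)
  refine summable_of_ne_finset_zero (s := Finset.Icc (n - 1) (n + 2)) fun j hj => ?_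
  by_contra h
  obtain ⟨h1, h2⟩ := hφ.bounds_of_ne_zero (by positivity) h
  refine hj (Finset.mem_Icc.2 ⟨?_, ?_⟩)
  · have : (2 : ℝ) ^ n ≤ 2 ^ (j + 1) := by
      rw [zpow_add_one₀ (by norm_num)]; linarith
    have := (zpow_le_zpow_iff_right₀ (one_lt_two : (1 : ℝ) < 2)).1 this
    omega
  · have : (2 : ℝ) ^ (j - 1) < 2 ^ (n + 1) := by
      rw [zpow_sub_one₀ (by norm_num)]; linarith
    have := (zpow_lt_zpow_iff_right₀ (one_lt_two : (1 : ℝ) < 2)).1 this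
    omega

theorem injective_succ_cast : Function.Injective fun k : ℕ => ((k + 1 : ℕ) : ℤ) := fun a b h => by
  simpa using h

theorem summable_succ (hφ : IsLPBump φ) (τ : ℝ) :
    Summable fun k : ℕ => φ (τ / 2 ^ (k + 1)) := by
  have := (hφ.summable_dyadic τ).comp_injective injective_succ_cast
  refine this.congr fun k => ?_
  simp only [Function.comp, zpow_natCast]

theorem lpSum_nonneg (hφ : IsLPBump φ) (τ : ℝ) : 0 ≤ lpSum φ τ :=
  tsum_nonneg fun _ => hφ.nonneg _

theorem lpSum_pos (hφ : IsLPBump φ) {τ : ℝ} (hτ : τ ≠ 0) : 0 < lpSum φ τ := by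
  obtain ⟨n, hn1, hn2⟩ := exists_mem_Ico_zpow (abs_pos.2 hτ) (one_lt_two)
  have h2n : (0 : ℝ) < 2 ^ n := by positivity
  have hs : (0 : ℝ) < Real.sqrt 2 := by positivity
  have hss : Real.sqrt 2 * Real.sqrt 2 = 2 := Real.mul_self_sqrt (by norm_num)
  have hs1 : 1 ≤ Real.sqrt 2 := by
    rw [Real.one_le_sqrt]; norm_num
  rw [zpow_add_one₀ (by norm_num)] at hn2
  suffices h : ∃ j : ℤ, 0 < φ (τ / 2 ^ j) by
    obtain ⟨j, hj⟩ := h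
    exact (hφ.summable_dyadic τ).tsum_pos (fun _ => hφ.nonneg _) j hj
  by_cases h : |τ| ≤ Real.sqrt 2 * 2 ^ n
  · refine ⟨n, hφ.pos _ ?_ ?_⟩
    · rw [abs_div, abs_of_pos h2n, div_le_div_iff₀ hs h2n]
      nlinarith
    · rwa [abs_div, abs_of_pos h2n, div_le_iff₀ h2n]
  · push Not at h
    have h2n' : (0 : ℝ) < 2 ^ (n + 1) := by positivity
    have e : (2 : ℝ) ^ (n + 1) = 2 ^ n * 2 := zpow_add_one₀ (by norm_num) _
    refine ⟨n + 1, hφ.pos _ ?_ ?_⟩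
    · rw [abs_div, abs_of_pos h2n', div_le_div_iff₀ hs h2n', e]
      nlinarith
    · rw [abs_div, abs_of_pos h2n', div_le_iff₀ h2n', e]
      nlinarith

theorem tsum_succ_le_lpSum (hφ : IsLPBump φ) (τ : ℝ) :
    ∑' k : ℕ, φ (τ / 2 ^ (k + 1)) ≤ lpSum φ τ := by
  refine (hφ.summable_succ τ).tsum_le_tsum_of_inj _ injective_succ_cast
    (fun _ _ => hφ.nonneg _) (fun k => ?_) (hφ.summable_dyadic τ)
  rw [zpow_natCast]

theorem tsum_succ_div_le_one (hφ : IsLPBump φ) (τ : ℝ) :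
    ∑' k : ℕ, φ (τ / 2 ^ (k + 1)) / lpSum φ τ ≤ 1 := by
  rw [tsum_div_const]
  exact div_le_one_of_le₀ (hφ.tsum_succ_le_lpSum τ) (hφ.lpSum_nonneg τ)

theorem lpPiece_nonneg (hφ : IsLPBump φ) (k : ℕ) (τ : ℝ) : 0 ≤ lpPiece φ k τ := by
  cases k with
  | zero => exact sub_nonneg.2 (hφ.tsum_succ_div_le_one τ)
  | succ k => exact div_nonneg (hφ.nonneg _) (hφ.lpSum_nonneg τ)

theorem tsum_ofReal_lpPiece (hφ : IsLPBump φ) (τ : ℝ) :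
    ∑' k : ℕ, ENNReal.ofReal (lpPiece φ k τ) = 1 := by
  rw [tsum_eq_zero_add' ENNReal.summable]
  have h : ∑' k : ℕ, ENNReal.ofReal (lpPiece φ (k + 1) τ) =
      ENNReal.ofReal (∑' k : ℕ, φ (τ / 2 ^ (k + 1)) / lpSum φ τ) :=
    (ENNReal.ofReal_tsum_of_nonneg (fun k => hφ.lpPiece_nonneg (k + 1) τ)
      ((hφ.summable_succ τ).div_const _)).symm
  have h2 : 0 ≤ ∑' k : ℕ, φ (τ / 2 ^ (k + 1)) / lpSum φ τ :=
    tsum_nonneg fun k => hφ.lpPiece_nonneg (k + 1) τ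
  rw [h, ← ENNReal.ofReal_add (hφ.lpPiece_nonneg 0 τ) h2]
  simp [lpPiece]

theorem abs_le_of_lpPiece_zero_ne_zero (hφ : IsLPBump φ) {τ : ℝ} (h : lpPiece φ 0 τ ≠ 0) :
    |τ| ≤ 2 := by
  by_contra! hτ
  refine h ?_
  have hpos := hφ.lpSum_pos (τ := τ) (by rintro rfl; norm_num at hτ)
  have e : ∑' k : ℕ, φ (τ / 2 ^ (k + 1)) = lpSum φ τ := by
    rw [lpSum, ← injective_succ_cast.tsum_eq]
    · simp only [zpow_natCast]
    · intro j hj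
      have h2 := (hφ.bounds_of_ne_zero (by positivity) hj).2
      have h3 : (2 : ℝ) ^ (0 : ℤ) < 2 ^ j := by rw [zpow_zero]; linarith
      have h4 := (zpow_lt_zpow_iff_right₀ (one_lt_two : (1 : ℝ) < 2)).1 h3
      exact ⟨(j - 1).toNat, by simp only; omega⟩
  rw [lpPiece, tsum_div_const, e, div_self hpos.ne', sub_self]

theorem measurable_lpSum (hφ : IsLPBump φ) : Measurable (lpSum φ) := by
  have hc := hφ.smooth.continuous.measurable
  have e : lpSum φ = fun τ => (∑' j : ℤ, ENNReal.ofReal (φ (τ / 2 ^ j))).toReal := by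
    funext τ
    rw [ENNReal.tsum_toReal_eq fun _ => ENNReal.ofReal_ne_top]
    simp only [ENNReal.toReal_ofReal (hφ.nonneg _), lpSum]
  rw [e]
  exact (Measurable.tsum fun j => by fun_prop).ennreal_toReal

theorem measurable_lpPiece (hφ : IsLPBump φ) (k : ℕ) : Measurable (lpPiece φ k) := by
  have hc := hφ.smooth.continuous.measurable
  have hs := hφ.measurable_lpSum
  have hsucc : ∀ k, Measurable (lpPiece φ (k + 1)) := fun k => by
    change Measurable fun τ => φ (τ / 2 ^ (k + 1)) / lpSum φ τ
    fun_prop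
  cases k with
  | succ k => exact hsucc k
  | zero =>
    have e : lpPiece φ 0 =
        fun τ => 1 - (∑' k : ℕ, ENNReal.ofReal (lpPiece φ (k + 1) τ)).toReal := by
      funext τ
      rw [ENNReal.tsum_toReal_eq fun _ => ENNReal.ofReal_ne_top]
      simp only [ENNReal.toReal_ofReal (hφ.lpPiece_nonneg _ _)]
      simp only [lpPiece]
    rw [e]
    exact measurable_const.sub
      (Measurable.tsum fun k => (hsucc k).ennreal_ofReal).ennreal_toReal

/-- The Littlewood–Paley pieces in the unit-frequency normalisation form a dyadic partition. -/
theorem isDyadicPartition (hφ : IsLPBump φ) :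
    IsDyadicPartition fun k w => ENNReal.ofReal (lpPiece φ k (2 * Real.pi * w)) where
  measurable k := by
    have := hφ.measurable_lpPiece k
    fun_prop
  tsum_eq_one w := hφ.tsum_ofReal_lpPiece _
  abs_le k w h := by
    have h' : lpPiece φ k (2 * Real.pi * w) ≠ 0 := fun h0 => h (by simp [h0])
    have hpi := Real.pi_gt_three
    have hb : |2 * Real.pi * w| ≤ 2 * 2 ^ k := by
      cases k with
      | zero => simpa using hφ.abs_le_of_lpPiece_zero_ne_zero h'
      | succ k =>
        exact (hφ.bounds_of_ne_zero (by positivity) (div_ne_zero_iff.1 h').1).2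
    rw [abs_mul, abs_of_pos (by positivity)] at hb
    nlinarith [abs_nonneg w]
  le_abs k w h hk := by
    have h' : lpPiece φ k (2 * Real.pi * w) ≠ 0 := fun h0 => h (by simp [h0])
    have hpi := Real.pi_le_four
    cases k with
    | zero => exact absurd rfl hk
    | succ k =>
      have hb := (hφ.bounds_of_ne_zero (by positivity) (div_ne_zero_iff.1 h').1).1
      rw [abs_mul, abs_of_pos (by positivity)] at hb
      nlinarith [abs_nonneg w]

theorem lpKernel_eq_fourierInv (φ : ℝ → ℝ) (k : ℕ) :
    lpKernel φ k = 𝓕⁻ fun w : ℝ => (lpPiece φ k (2 * Real.pi * w) : ℂ) := by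
  funext t
  rw [Real.fourierInv_eq', lpKernel]
  have h := Measure.integral_comp_mul_left (fun τ : ℝ =>
    Complex.exp (Complex.I * ((t * τ : ℝ) : ℂ)) * (lpPiece φ k τ : ℂ)) (2 * Real.pi)
  rw [abs_of_pos (by positivity)] at h
  rw [← h]
  refine integral_congr_ae (.of_forall fun w => ?_)
  simp only [smul_eq_mul, RCLike.inner_apply, conj_trivial]
  congr 2
  push_cast
  ring

theorem enorm_lpPiece (hφ : IsLPBump φ) (k : ℕ) (w : ℝ) :
    ‖(lpPiece φ k (2 * Real.pi * w) : ℂ)‖ₑ = ENNReal.ofReal (lpPiece φ k (2 * Real.pi * w)) := by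
  rw [← ofReal_norm, Complex.norm_real, Real.norm_of_nonneg (hφ.lpPiece_nonneg k _)]

theorem measurable_multiplier (hφ : IsLPBump φ) (k : ℕ) :
    Measurable fun w : ℝ => (lpPiece φ k (2 * Real.pi * w) : ℂ) := by
  have := hφ.measurable_lpPiece k
  fun_prop

theorem norm_lpPiece_le_indicator (hφ : IsLPBump φ) (k : ℕ) (w : ℝ) :
    ‖(lpPiece φ k (2 * Real.pi * w) : ℂ)‖ ≤ (Set.Icc (-2 ^ k) (2 ^ k)).indicator 1 w := by
  have h := hφ.isDyadicPartition.le_one k w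
  simp only [ENNReal.ofReal_le_one] at h
  rw [Complex.norm_real, Real.norm_of_nonneg (hφ.lpPiece_nonneg k _)]
  by_cases hw : lpPiece φ k (2 * Real.pi * w) = 0
  · rw [hw]
    exact Set.indicator_nonneg (fun _ _ => zero_le_one) _
  · have := hφ.isDyadicPartition.abs_le k w (by
      simpa using lt_of_le_of_ne (hφ.lpPiece_nonneg k _) (Ne.symm hw))
    rw [Set.indicator_of_mem (by exact abs_le.1 this)]
    exact h

theorem memLp_multiplier_mul (hφ : IsLPBump φ) (k : ℕ) {f : ℝ → ℂ} (hf : Measurable f) {C : ℝ}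
    (hC : ∀ w, ‖f w‖ ≤ C) (p : ℝ≥0∞) :
    MemLp (fun w => (lpPiece φ k (2 * Real.pi * w) : ℂ) * f w) p := by
  have hind : MemLp ((Set.Icc (-2 ^ k : ℝ) (2 ^ k)).indicator fun _ => C) p :=
    memLp_indicator_const p measurableSet_Icc C (Or.inr (by simp))
  refine hind.mono' ((hφ.measurable_multiplier k).mul hf).aestronglyMeasurable
    (.of_forall fun w => ?_)
  have hC0 : 0 ≤ C := (norm_nonneg _).trans (hC w)
  have h := hφ.norm_lpPiece_le_indicator k w
  rw [norm_mul]
  by_cases hw : w ∈ Set.Icc (-2 ^ k : ℝ) (2 ^ k)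
  · rw [Set.indicator_of_mem hw] at h ⊢
    exact (mul_le_mul h (hC w) (norm_nonneg _) zero_le_one).trans_eq (one_mul C)
  · rw [Set.indicator_of_notMem hw] at h ⊢
    exact (mul_le_mul h (hC w) (norm_nonneg _) le_rfl).trans_eq (zero_mul C)

theorem memLp_multiplier_mul_fourier (hφ : IsLPBump φ) (k : ℕ) {g : ℝ → ℂ}
    (hg : Integrable g) (p : ℝ≥0∞) :
    MemLp (fun w => (lpPiece φ k (2 * Real.pi * w) : ℂ) * 𝓕 g w) p :=
  hφ.memLp_multiplier_mul k (continuous_fourier_of_integrable hg).measurable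
    (norm_fourier_le_integral_norm g) p

theorem convR_lpKernel (hφ : IsLPBump φ) (k : ℕ) {g : ℝ → ℂ} (hg : Integrable g) (t : ℝ) :
    convR (lpKernel φ k) g t =
      𝓕⁻ (fun w => (lpPiece φ k (2 * Real.pi * w) : ℂ) * 𝓕 g w) t := by
  have hM : Integrable fun w : ℝ => (lpPiece φ k (2 * Real.pi * w) : ℂ) *
      Complex.exp (((2 * Real.pi * (w * t) : ℝ) : ℂ) * Complex.I) :=
    memLp_one_iff_integrable.1 (hφ.memLp_multiplier_mul k (by fun_prop) (C := 1)
      (fun w => (Complex.norm_exp_ofReal_mul_I _).le) 1)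
  have h := integral_fourier_mul_eq hg hM
  rw [Real.fourierInv_eq']
  simp only [smul_eq_mul, RCLike.inner_apply, conj_trivial]
  calc convR (lpKernel φ k) g t = ∫ s, g s * 𝓕 (fun w : ℝ => (lpPiece φ k (2 * Real.pi * w) : ℂ) *
      Complex.exp (((2 * Real.pi * (w * t) : ℝ) : ℂ) * Complex.I)) s := by
        rw [convR]
        refine integral_congr_ae (.of_forall fun s => ?_)
        simp only [lpKernel_eq_fourierInv, Real.fourierInv_eq', Real.fourier_eq', smul_eq_mul,
          RCLike.inner_apply, conj_trivial]
        rw [mul_comm]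
        congr 1
        refine integral_congr_ae (.of_forall fun w => ?_)
        simp only
        rw [mul_left_comm (Complex.exp _), ← Complex.exp_add, mul_comm]
        congr 2
        push_cast
        ring
    _ = _ := by
        rw [← h]
        refine integral_congr_ae (.of_forall fun w => ?_)
        simp only
        rw [show t * w = w * t from mul_comm _ _]
        ring

theorem lintegral_enorm_convR_sq (hφ : IsLPBump φ) (k : ℕ) {g : ℝ → ℂ} (hg : Integrable g) :
    ∫⁻ t, ‖convR (lpKernel φ k) g t‖ₑ ^ 2 =
      ∫⁻ w, (ENNReal.ofReal (lpPiece φ k (2 * Real.pi * w)) * ‖𝓕 g w‖ₑ) ^ 2 := by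
  simp only [hφ.convR_lpKernel k hg]
  rw [lintegral_enorm_fourierInv_sq
    (memLp_one_iff_integrable.1 (hφ.memLp_multiplier_mul_fourier k hg 1))
    (hφ.memLp_multiplier_mul_fourier k hg 2)]
  simp only [enorm_mul, hφ.enorm_lpPiece]

end IsLPBump

theorem measurable_fourier_slice {v : SpaceTime → ℂ} (hv : Measurable v) :
    Measurable fun p : SpaceTime => 𝓕 (fun s => v (s, p.2)) p.1 := by
  simp only [Real.fourier_eq', smul_eq_mul, RCLike.inner_apply, conj_trivial]
  have h : Measurable fun q : SpaceTime × ℝ =>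
      Complex.exp (((-2 * Real.pi * (q.1.1 * q.2) : ℝ) : ℂ) * Complex.I) * v (q.2, q.1.2) := by
    fun_prop
  exact h.stronglyMeasurable.integral_prod_right.measurable

theorem measurable_fourierInv_slice {v : SpaceTime → ℂ} (hv : Measurable v) :
    Measurable fun p : SpaceTime => 𝓕⁻ (fun s => v (s, p.2)) p.1 := by
  simp only [Real.fourierInv_eq', smul_eq_mul, RCLike.inner_apply, conj_trivial]
  have h : Measurable fun q : SpaceTime × ℝ =>
      Complex.exp (((2 * Real.pi * (q.1.1 * q.2) : ℝ) : ℂ) * Complex.I) * v (q.2, q.1.2) := by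
    fun_prop
  exact h.stronglyMeasurable.integral_prod_right.measurable

theorem lTwo_toReal {Ω : Type*} [MeasurableSpace Ω] {μ : Measure Ω} {f : Ω → ℂ}
    (hf : AEStronglyMeasurable f μ) :
    Real.sqrt (∫ p, ‖f p‖ ^ 2 ∂μ) = (lTwo μ fun p => ‖f p‖ₑ).toReal := by
  rw [integral_eq_lintegral_of_nonneg_ae (.of_forall fun _ => by positivity) (by fun_prop), lTwo,
    ← ENNReal.toReal_rpow, ← Real.sqrt_eq_rpow]
  congr 2
  refine lintegral_congr fun p => ?_
  rw [ENNReal.ofReal_pow (norm_nonneg _), ofReal_norm]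

theorem lTwo_fourier_slice {v : SpaceTime → ℂ} (hv : Measurable v)
    (h1 : ∀ x, Integrable fun s => v (s, x)) (h2 : ∀ x, MemLp (fun s => v (s, x)) 2) :
    lTwo volume (fun p : SpaceTime => ‖𝓕 (fun s => v (s, p.2)) p.1‖ₑ) =
      lTwo volume fun p => ‖v p‖ₑ := by
  have hm := measurable_fourier_slice hv
  simp only [lTwo, Measure.volume_eq_prod]
  rw [lintegral_prod_symm' _ (by fun_prop), lintegral_prod_symm' _ (by fun_prop)]
  simp only [lintegral_enorm_fourier_sq (h1 _) (h2 _)]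

namespace IsLPBump

variable {φ : ℝ → ℝ}

theorem measurable_convT (hφ : IsLPBump φ) (k : ℕ) {v : SpaceTime → ℂ} (hv : Measurable v)
    (h1 : ∀ x, Integrable fun s => v (s, x)) : Measurable (convT (lpKernel φ k) v) := by
  have e : convT (lpKernel φ k) v = fun p => 𝓕⁻ (fun w =>
      (lpPiece φ k (2 * Real.pi * w) : ℂ) * 𝓕 (fun s => v (s, p.2)) w) p.1 :=
    funext fun p => hφ.convR_lpKernel k (h1 p.2) p.1
  rw [e]
  have hm := measurable_fourier_slice hv
  have hk := hφ.measurable_multiplier k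
  exact measurable_fourierInv_slice (v := fun p : SpaceTime =>
      (lpPiece φ k (2 * Real.pi * p.1) : ℂ) * 𝓕 (fun s => v (s, p.2)) p.1)
    ((hk.comp measurable_fst).mul hm)

theorem l2ST_convT (hφ : IsLPBump φ) (k : ℕ) {v : SpaceTime → ℂ} (hv : Measurable v)
    (h1 : ∀ x, Integrable fun s => v (s, x)) :
    l2ST (convT (lpKernel φ k) v) = (lTwo volume fun p : SpaceTime =>
      ENNReal.ofReal (lpPiece φ k (2 * Real.pi * p.1)) *
        ‖𝓕 (fun s => v (s, p.2)) p.1‖ₑ).toReal := by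
  have hc := hφ.measurable_convT k hv h1
  have hm := measurable_fourier_slice hv
  have hk := hφ.measurable_lpPiece k
  rw [l2ST, lTwo_toReal hc.aestronglyMeasurable]
  simp only [lTwo, Measure.volume_eq_prod]
  rw [lintegral_prod_symm' _ (by fun_prop), lintegral_prod_symm' _ (by fun_prop)]
  simp only [← hφ.lintegral_enorm_convR_sq k (h1 _)]
  rfl

theorem l2R_convR (hφ : IsLPBump φ) (k : ℕ) {g : ℝ → ℂ} (hg : Integrable g) :
    l2R (convR (lpKernel φ k) g) = (lTwo volume fun w =>
      ENNReal.ofReal (lpPiece φ k (2 * Real.pi * w)) * ‖𝓕 g w‖ₑ).toReal := by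
  have hc : Measurable (convR (lpKernel φ k) g) := by
    rw [show convR (lpKernel φ k) g = _ from funext fun t => hφ.convR_lpKernel k hg t,
      show 𝓕⁻ (fun w => (lpPiece φ k (2 * Real.pi * w) : ℂ) * 𝓕 g w) = _ from
        funext fun w => Real.fourierInv_eq_fourier_neg _ w]
    exact ((continuous_fourier_of_integrable (memLp_one_iff_integrable.1
      (hφ.memLp_multiplier_mul_fourier k hg 1))).comp continuous_neg).measurable
  rw [l2R, lTwo_toReal hc.aestronglyMeasurable, lTwo, hφ.lintegral_enorm_convR_sq k hg, lTwo]

end IsLPBump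

theorem lTwo_enorm_ne_top {Ω : Type*} [MeasurableSpace Ω] {μ : Measure Ω} {f : Ω → ℂ}
    (hf : MemLp f 2 μ) : lTwo μ (fun x => ‖f x‖ₑ) ≠ ⊤ := by
  rw [lTwo, lintegral_enorm_sq_eq_eLpNorm_sq, sq_rpow_half]
  exact hf.2.ne

theorem enorm_mul_fourier_le {f : ℝ → ℂ} (hf : Integrable f) (h'f : Differentiable ℝ f)
    (hf' : Integrable (deriv f)) (w : ℝ) : ‖w‖ₑ * ‖𝓕 f w‖ₑ ≤ ‖𝓕 (deriv f) w‖ₑ := by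
  rw [Real.fourier_deriv hf h'f hf']
  simp only [← ofReal_norm, ← ENNReal.ofReal_mul (norm_nonneg w), norm_smul]
  refine ENNReal.ofReal_le_ofReal (mul_le_mul_of_nonneg_right ?_ (norm_nonneg _))
  simp only [norm_mul, Complex.norm_ofNat, Complex.norm_real, Complex.norm_I, mul_one,
    Real.norm_of_nonneg Real.pi_pos.le]
  nlinarith [norm_nonneg w, Real.pi_gt_three]

theorem tsum_two_rpow_mul_toReal {a : ℕ → ℝ} {T : ℕ → ℝ≥0∞}
    (h : ∑' k, (2 : ℝ≥0∞) ^ a k * T k ≠ ⊤) :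
    ∑' k, (2 : ℝ) ^ a k * (T k).toReal = (∑' k, (2 : ℝ≥0∞) ^ a k * T k).toReal := by
  rw [ENNReal.tsum_toReal_eq fun k => ENNReal.ne_top_of_tsum_ne_top h k]
  simp [ENNReal.toReal_mul, ← ENNReal.toReal_rpow]

/-- The restriction of a Schwartz function on space-time to the time line over `x`. -/
def timeSlice (u : SchwartzMap SpaceTime ℂ) (x : E2) : SchwartzMap ℝ ℂ :=
  SchwartzMap.compCLMOfAntilipschitz ℝ (K := 1) (g := fun t : ℝ => (t, x))
    (by
      have h := (ContinuousLinearMap.inl ℝ ℝ E2).hasTemperateGrowth.add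
        (Function.HasTemperateGrowth.const ((0, x) : SpaceTime))
      convert h using 1
      ext t <;> simp)
    (AntilipschitzWith.of_le_mul_dist fun s t => by simp [Prod.dist_eq]) u

theorem integrable_slice (u : SchwartzMap SpaceTime ℂ) (x : E2) :
    Integrable fun t => u (t, x) :=
  (timeSlice u x).integrable

theorem memLp_slice (u : SchwartzMap SpaceTime ℂ) (x : E2) : MemLp (fun t => u (t, x)) 2 :=
  (timeSlice u x).memLp 2 volume

theorem differentiable_slice (u : SchwartzMap SpaceTime ℂ) (x : E2) :
    Differentiable ℝ fun t => u (t, x) :=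
  (timeSlice u x).differentiable

open LineDeriv in
theorem deriv_slice (u : SchwartzMap SpaceTime ℂ) (x : E2) :
    deriv (fun s => u (s, x)) =
      fun t => (∂_{((1, 0) : SpaceTime)} u : SchwartzMap SpaceTime ℂ) (t, x) := by
  funext t
  have h : HasDerivAt (fun s : ℝ => ((s, x) : SpaceTime)) (1, 0) t :=
    (hasDerivAt_id t).prodMk (hasDerivAt_const t x)
  rw [SchwartzMap.lineDerivOp_apply_eq_fderiv]
  exact (u.differentiableAt.hasFDerivAt.comp_hasDerivAt t h).deriv

theorem integrable_mul_slice (ψ : SchwartzMap ℝ ℂ) (u : SchwartzMap SpaceTime ℂ) (x : E2) :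
    Integrable fun t => ψ t * u (t, x) :=
  (ψ.memLp 2).integrable_mul (memLp_slice u x)

theorem lTwo_fourier_schwartz_slice_ne_top (u : SchwartzMap SpaceTime ℂ) :
    lTwo volume (fun p : SpaceTime => ‖𝓕 (fun s => u (s, p.2)) p.1‖ₑ) ≠ ⊤ := by
  rw [lTwo_fourier_slice u.continuous.measurable (integrable_slice u) (memLp_slice u)]
  have : Measure.HasTemperateGrowth (volume : Measure SpaceTime) := by
    rw [Measure.volume_eq_prod]
    infer_instance
  exact lTwo_enorm_ne_top (u.memLp 2)

theorem lTwo_mul_fourier_schwartz_slice_ne_top (u : SchwartzMap SpaceTime ℂ) :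
    lTwo volume (fun p : SpaceTime => ‖p.1‖ₑ * ‖𝓕 (fun s => u (s, p.2)) p.1‖ₑ) ≠ ⊤ := by
  refine ne_top_of_le_ne_top (lTwo_fourier_schwartz_slice_ne_top
    (LineDeriv.lineDerivOp ((1, 0) : SpaceTime) u)) (lTwo_mono fun p => ?_)
  have h := enorm_mul_fourier_le (integrable_slice u p.2) (differentiable_slice u p.2)
    (by rw [deriv_slice]; exact integrable_slice _ _) p.1
  rwa [deriv_slice] at h

theorem lTwo_fourier_schwartz_ne_top (ψ : SchwartzMap ℝ ℂ) :
    lTwo volume (fun w => ‖𝓕 (fun t => ψ t) w‖ₑ) ≠ ⊤ := by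
  rw [lTwo, lintegral_enorm_fourier_sq ψ.integrable (ψ.memLp 2)]
  exact lTwo_enorm_ne_top (ψ.memLp 2)

theorem lTwo_mul_fourier_schwartz_ne_top (ψ : SchwartzMap ℝ ℂ) :
    lTwo volume (fun w => ‖w‖ₑ * ‖𝓕 (fun t => ψ t) w‖ₑ) ≠ ⊤ :=
  ne_top_of_le_ne_top (lTwo_fourier_schwartz_ne_top (SchwartzMap.derivCLM ℝ ℂ ψ))
    (lTwo_mono fun w => enorm_mul_fourier_le ψ.integrable ψ.differentiable
      (SchwartzMap.derivCLM ℝ ℂ ψ).integrable w)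

/-- One-dimensional Besov multiplication law: for 0 < b ≤ 1/2,
    ‖ψu‖_{B^b_{2,1}L²_x} ≤ c ‖ψ‖_{B^b_{2,1}} ‖u‖_{B^{1/2}_{2,1}L²_x}. -/
theorem besov_multiplication_law :
    ∀ φ : ℝ → ℝ, IsLPBump φ →
      ∀ b : ℝ, 0 < b → b ≤ 1 / 2 →
        ∃ c : ℝ,
          ∀ (ψ : SchwartzMap ℝ ℂ) (u : SchwartzMap SpaceTime ℂ),
            (∑' k : ℕ, (2 : ℝ) ^ (b * k) *
                l2ST (convT (lpKernel φ k) (fun p => ψ p.1 * u p))) ≤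
              c * (∑' k : ℕ, (2 : ℝ) ^ (b * k) * l2R (convR (lpKernel φ k) (fun t => ψ t))) *
                (∑' k : ℕ, (2 : ℝ) ^ ((k : ℝ) / 2) * l2ST (convT (lpKernel φ k) (fun p => u p))) := by
  intro φ hφ b hb0 hb
  refine ⟨(IsDyadicPartition.productConst b).toReal, fun ψ u => ?_⟩
  have hm := hφ.isDyadicPartition
  have hψm : Measurable fun w => ‖𝓕 (fun t => ψ t) w‖ₑ :=
    (continuous_fourier_of_integrable ψ.integrable).measurable.enorm
  have hum := (measurable_fourier_slice u.continuous.measurable).enorm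
  have hc : Continuous fun p : SpaceTime => ψ p.1 * u p := by fun_prop
  have hA := hm.tsum_weight_mul_lTwo_ne_top measurable_id hψm (lTwo_fourier_schwartz_ne_top ψ)
    (lTwo_mul_fourier_schwartz_ne_top ψ) hb
  have hB := hm.tsum_weight_mul_lTwo_ne_top measurable_fst hum
    (lTwo_fourier_schwartz_slice_ne_top u) (lTwo_mul_fourier_schwartz_slice_ne_top u) le_rfl
  simp only [id_eq] at hA
  simp only [one_div_mul_eq_div] at hB
  have key := hm.tsum_mul_le (ν := (volume : Measure E2)) hψm hum
    (h := fun p : SpaceTime => ‖𝓕 (fun s => ψ s * u (s, p.2)) p.1‖ₑ)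
    (fun w x => enorm_fourier_mul_le ψ (integrable_slice u x) w) hb
  rw [← Measure.volume_eq_prod] at key
  have hR := ENNReal.mul_ne_top (ENNReal.mul_ne_top (IsDyadicPartition.productConst_ne_top hb0) hA) hB
  simp only [hφ.l2ST_convT _ hc.measurable (integrable_mul_slice ψ u),
    hφ.l2ST_convT _ u.continuous.measurable (integrable_slice u),
    hφ.l2R_convR _ (g := fun t => ψ t) ψ.integrable]
  rw [tsum_two_rpow_mul_toReal (ne_top_of_le_ne_top hR key), tsum_two_rpow_mul_toReal hA,
    tsum_two_rpow_mul_toReal hB, ← ENNReal.toReal_mul, ← ENNReal.toReal_mul]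
  exact ENNReal.toReal_mono hR key
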